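/- arXiv:2107.13524 — 8 statements merged into one kernel-verified Lean document; each statement's English description precedes it below -/
import Mathlib

section
/- Cauchy criterion for differentiability (Macbeath): the function f is differentiable at 0 if and only if the following determinant condition holds: for every ε > 0 there exists δ > 0 such that for every family of n+1 vectors x₀, …, xₙ in EuclideanSpace ℝ (Fin n) with ‖xⱼ‖ < δ for all j, the absolute value of the determinant of the (n+1)×(n+1) real matrix whose j-th row is (f(xⱼ), xⱼ⁰, …, xⱼ^{n−1}) is at most ε · ∏_{j} ‖xⱼ‖. -/
open Filter Asymptotics Topology

/-- Column operation: subtract a linear combination of the coordinates from column zero. -/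
lemma det_cons_sub {n : ℕ} (r : Fin (n + 1) → ℝ) (x : Fin (n + 1) → EuclideanSpace ℝ (Fin n))
    (a : Fin n → ℝ) :
    (Matrix.of fun j : Fin (n + 1) =>
        (Fin.cons (r j) (fun i : Fin n => x j i) : Fin (n + 1) → ℝ)).det
      = (Matrix.of fun j : Fin (n + 1) =>
        (Fin.cons (r j - ∑ i, a i * x j i) (fun i : Fin n => x j i) : Fin (n + 1) → ℝ)).det := by
  have h0 : (Matrix.of fun j : Fin (n + 1) =>
        (Fin.cons (∑ i, a i * x j i) (fun i : Fin n => x j i) : Fin (n + 1) → ℝ)).det = 0 := by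
    rw [← Matrix.exists_mulVec_eq_zero_iff]
    refine ⟨(Fin.cons (-1) a : Fin (n + 1) → ℝ), ?_, ?_⟩
    · intro h
      have := congrFun h 0
      simp at this
    · ext j
      simp [Matrix.mulVec, dotProduct, Fin.sum_univ_succ, mul_comm]
  rw [← sub_zero (Matrix.det _), ← h0]
  simp only [Matrix.det_succ_column_zero, ← Finset.sum_sub_distrib]
  refine Finset.sum_congr rfl fun j _ => ?_
  simp only [Matrix.of_apply, Fin.cons_zero]
  have e : ∀ r : Fin (n + 1) → ℝ, ((Matrix.of fun j : Fin (n + 1) =>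
      (Fin.cons (r j) (fun i : Fin n => x j i) : Fin (n + 1) → ℝ)).submatrix j.succAbove Fin.succ)
      = Matrix.of fun k i : Fin n => x (j.succAbove k) i := by
    intro r
    ext k i
    simp
  rw [e, e, e]
  ring

lemma abs_det_cons_le {n : ℕ} (r : Fin (n + 1) → ℝ) (x : Fin (n + 1) → EuclideanSpace ℝ (Fin n))
    (c : ℝ) (h : ∀ j, |r j| ≤ c * ‖x j‖) :
    |(Matrix.of fun j : Fin (n + 1) =>
        (Fin.cons (r j) (fun i : Fin n => x j i) : Fin (n + 1) → ℝ)).det|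
      ≤ (n + 1).factorial * (c * ∏ j, ‖x j‖) := by
  rw [Matrix.det_apply]
  refine (Finset.abs_sum_le_sum_abs _ _).trans ?_
  have : ((n + 1).factorial : ℝ) * (c * ∏ j, ‖x j‖)
      = ∑ _σ : Equiv.Perm (Fin (n + 1)), (c * ∏ j, ‖x j‖) := by
    simp [Fintype.card_perm]
  rw [this]
  refine Finset.sum_le_sum fun σ _ => ?_
  rw [← Equiv.prod_comp σ (fun j => ‖x j‖)]
  have hs : ∀ y : ℝ, |Equiv.Perm.sign σ • y| = |y| := by
    intro y
    rcases Int.units_eq_one_or (Equiv.Perm.sign σ) with h | h <;> simp [h]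
  rw [hs, Finset.abs_prod, Fin.prod_univ_succ, Fin.prod_univ_succ, ← mul_assoc]
  simp only [Matrix.of_apply, Fin.cons_zero, Fin.cons_succ]
  refine mul_le_mul (h _) ?_ (Finset.prod_nonneg fun _ _ => abs_nonneg _)
    ((abs_nonneg _).trans (h _))
  refine Finset.prod_le_prod (fun _ _ => abs_nonneg _) fun i _ => ?_
  simpa using PiLp.norm_apply_le (x (σ i.succ)) i

lemma det_cons_single {n : ℕ} (f : EuclideanSpace ℝ (Fin n) → ℝ) (y : EuclideanSpace ℝ (Fin n))
    (t : ℝ) (ht : t ≠ 0) :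
    (Matrix.of fun j : Fin (n + 1) =>
        (Fin.cons (f ((Fin.cons y (fun i => EuclideanSpace.single i t) :
            Fin (n + 1) → EuclideanSpace ℝ (Fin n)) j))
          (fun i : Fin n => (Fin.cons y (fun i => EuclideanSpace.single i t) :
            Fin (n + 1) → EuclideanSpace ℝ (Fin n)) j i) : Fin (n + 1) → ℝ)).det
      = (f y - ∑ i, (f (EuclideanSpace.single i t) / t) * y i) * t ^ n := by
  rw [det_cons_sub (fun j => f ((Fin.cons y (fun i => EuclideanSpace.single i t) :
            Fin (n + 1) → EuclideanSpace ℝ (Fin n)) j)) _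
            (fun i => f (EuclideanSpace.single i t) / t)]
  rw [Matrix.det_succ_column_zero, Fin.sum_univ_succ]
  have h1 : ∀ i : Fin n, f (EuclideanSpace.single i t) -
      ∑ k, f (EuclideanSpace.single k t) / t * (EuclideanSpace.single i t : EuclideanSpace ℝ (Fin n)) k
      = 0 := by
    intro i
    simp [Pi.single_apply, ht]
  have h2 : ((Matrix.of fun j : Fin (n + 1) =>
        (Fin.cons (f ((Fin.cons y (fun i => EuclideanSpace.single i t) :
            Fin (n + 1) → EuclideanSpace ℝ (Fin n)) j) - ∑ i, f (EuclideanSpace.single i t) / t *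
            (Fin.cons y (fun i => EuclideanSpace.single i t) :
            Fin (n + 1) → EuclideanSpace ℝ (Fin n)) j i)
          (fun i : Fin n => (Fin.cons y (fun i => EuclideanSpace.single i t) :
            Fin (n + 1) → EuclideanSpace ℝ (Fin n)) j i) : Fin (n + 1) → ℝ)).submatrix
            (Fin.succAbove 0) Fin.succ) = Matrix.diagonal fun _ => t := by
    ext k i
    simp [Matrix.diagonal_apply, Pi.single_apply, eq_comm]
  rw [h2, Matrix.det_diagonal]
  simp only [Matrix.of_apply, Fin.cons_zero, Fin.cons_succ, h1]
  simp

/-- **Cauchy criterion for differentiability (Macbeath).** A function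
`f : EuclideanSpace ℝ (Fin n) → ℝ` (`n ≥ 1`, `f 0 = 0`) is differentiable at the
origin if and only if for every `ε > 0` there is `δ > 0` such that for all families
of `n + 1` vectors `x j` with `‖x j‖ < δ`, the determinant of the
`(n+1) × (n+1)` matrix whose `j`-th row is `(f (x j), x j 0, …, x j (n-1))`
satisfies `|det| ≤ ε * ∏ j, ‖x j‖`. -/
theorem cauchy_criterion (n : ℕ) (hn : 1 ≤ n) (f : EuclideanSpace ℝ (Fin n) → ℝ)
    (hf : f 0 = 0) :
    DifferentiableAt ℝ f 0 ↔
      ∀ ε > (0 : ℝ), ∃ δ > (0 : ℝ),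
        ∀ x : Fin (n + 1) → EuclideanSpace ℝ (Fin n), (∀ j, ‖x j‖ < δ) →
          |(Matrix.of fun j : Fin (n + 1) =>
              Fin.cons (f (x j)) (fun i : Fin n => x j i)).det|
            ≤ ε * ∏ j : Fin (n + 1), ‖x j‖ := by
  constructor
  · intro hd ε hε
    have hF := hd.hasFDerivAt
    set L := fderiv ℝ f 0
    have hN : (0 : ℝ) < (n + 1).factorial := by positivity
    have ho := hF.isLittleO
    have hb := ho.def (div_pos hε hN)
    obtain ⟨δ, hδ, hB⟩ := Metric.eventually_nhds_iff.1 hb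
    refine ⟨δ, hδ, fun x hx => ?_⟩
    rw [det_cons_sub (fun j => f (x j)) x (fun i => L (EuclideanSpace.single i 1))]
    refine (abs_det_cons_le _ x (ε / (n + 1).factorial) fun j => ?_).trans (le_of_eq ?_)
    · have := hB (y := x j) (by simpa using hx j)
      have hL : L (x j) = ∑ i, L (EuclideanSpace.single i 1) * x j i := by
        conv_lhs => rw [← (EuclideanSpace.basisFun (Fin n) ℝ).sum_repr (x j)]
        simp [mul_comm]
      rw [← hL]
      simpa [hf] using this
    · field_simp
  · intro h
    have key : ∀ ε > (0 : ℝ), ∃ δ > (0 : ℝ), ∀ y : EuclideanSpace ℝ (Fin n), ‖y‖ < δ →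
        ∀ t : ℝ, 0 < t → t < δ →
          |f y - ∑ i, (f (EuclideanSpace.single i t) / t) * y i| ≤ ε * ‖y‖ := by
      intro ε hε
      obtain ⟨δ, hδ, H⟩ := h ε hε
      refine ⟨δ, hδ, fun y hy t ht htδ => ?_⟩
      have := H (Fin.cons y (fun i => EuclideanSpace.single i t)) (by
        intro j
        refine Fin.cases ?_ (fun i => ?_) j
        · simpa using hy
        · simpa [abs_of_pos ht] using htδ)
      rw [det_cons_single f y t ht.ne', abs_mul, Fin.prod_univ_succ] at this
      simp only [Fin.cons_zero, Fin.cons_succ, EuclideanSpace.norm_single, Real.norm_eq_abs,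
        Finset.prod_const, Finset.card_univ, Fintype.card_fin, abs_pow, abs_of_pos ht] at this
      rw [← mul_assoc] at this
      exact le_of_mul_le_mul_right this (pow_pos ht n)
    let u : ℕ → ℝ := fun k => 1 / ((k : ℝ) + 1)
    have hu0 : ∀ k, 0 < u k := fun k => by positivity
    have hu : Tendsto u atTop (𝓝 0) := tendsto_one_div_add_atTop_nhds_zero_nat
    have hlim : ∀ i : Fin n, ∃ a : ℝ,
        Tendsto (fun k => f (EuclideanSpace.single i (u k)) / u k) atTop (𝓝 a) := by
      intro i
      apply cauchySeq_tendsto_of_complete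
      rw [Metric.cauchySeq_iff]
      intro ε hε
      obtain ⟨δ, hδ, H⟩ := key (ε / 2) (by positivity)
      obtain ⟨N, hN⟩ := eventually_atTop.1 (hu.eventually (gt_mem_nhds hδ))
      refine ⟨N, fun p hp q hq => ?_⟩
      have := H (EuclideanSpace.single i (u p)) (by simpa [abs_of_pos (hu0 p)] using hN p hp)
        (u q) (hu0 q) (hN q hq)
      have e : f (EuclideanSpace.single i (u p)) - ∑ k, f (EuclideanSpace.single k (u q)) / u q *
          (EuclideanSpace.single i (u p) : EuclideanSpace ℝ (Fin n)) k
          = (f (EuclideanSpace.single i (u p)) / u p - f (EuclideanSpace.single i (u q)) / u q)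
            * u p := by
        have := (hu0 p).ne'
        rw [sub_mul, div_mul_cancel₀ _ this]
        simp [Pi.single_apply]
      rw [e, abs_mul, EuclideanSpace.norm_single, Real.norm_eq_abs] at this
      have := le_of_mul_le_mul_right this (abs_pos.2 (hu0 p).ne')
      rw [Real.dist_eq]
      linarith
    choose a ha using hlim
    let L : EuclideanSpace ℝ (Fin n) →L[ℝ] ℝ := ∑ i, a i • EuclideanSpace.proj i
    have hL : ∀ y, L y = ∑ i, a i * y i := by
      intro y
      simp [L]
    refine HasFDerivAt.differentiableAt (f' := L) (HasFDerivAt.of_isLittleO ?_)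
    rw [isLittleO_iff]
    intro ε hε
    obtain ⟨δ, hδ, H⟩ := key ε hε
    rw [Metric.eventually_nhds_iff]
    refine ⟨δ, hδ, fun y hy => ?_⟩
    simp only [hf, sub_zero, hL, Real.norm_eq_abs]
    have hT : Tendsto (fun k => |f y - ∑ i, (f (EuclideanSpace.single i (u k)) / u k) * y i|)
        atTop (𝓝 |f y - ∑ i, a i * y i|) :=
      (tendsto_const_nhds.sub (tendsto_finsetSum _ fun i _ => (ha i).mul_const _)).abs
    refine le_of_tendsto hT ?_
    filter_upwards [hu.eventually (gt_mem_nhds hδ)] with k hk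
    exact H y (by simpa using hy) (u k) (hu0 k) hk
end

section
/- Necessity part of the Cauchy criterion: if f is differentiable at 0, then for every ε > 0 there exists δ > 0 such that for every family of n+1 vectors x₀, …, xₙ in EuclideanSpace ℝ (Fin n) with ‖xⱼ‖ < δ for all j, the absolute value of the determinant of the (n+1)×(n+1) real matrix whose j-th row is (f(xⱼ), xⱼ⁰, …, xⱼ^{n−1}) is at most ε · ∏_{j} ‖xⱼ‖. -/
open Filter Asymptotics Topology

/-- **Necessity part of the Cauchy criterion (Macbeath).** If
`f : EuclideanSpace ℝ (Fin n) → ℝ` (`n ≥ 1`, `f 0 = 0`) is differentiable at the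
origin, then for every `ε > 0` there is `δ > 0` such that for all families of
`n + 1` vectors `x j` with `‖x j‖ < δ`, the determinant of the `(n+1) × (n+1)`
matrix whose `j`-th row is `(f (x j), x j 0, …, x j (n-1))` satisfies
`|det| ≤ ε * ∏ j, ‖x j‖`. -/
theorem cauchy_criterion_necessity (n : ℕ) (hn : 1 ≤ n)
    (f : EuclideanSpace ℝ (Fin n) → ℝ) (hf : f 0 = 0)
    (hdiff : DifferentiableAt ℝ f 0) :
    ∀ ε > (0 : ℝ), ∃ δ > (0 : ℝ),
      ∀ x : Fin (n + 1) → EuclideanSpace ℝ (Fin n), (∀ j, ‖x j‖ < δ) →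
        |(Matrix.of fun j : Fin (n + 1) =>
            Fin.cons (f (x j)) (fun i : Fin n => x j i)).det|
          ≤ ε * ∏ j : Fin (n + 1), ‖x j‖ := by
  intro ε hε
  have hN : (0 : ℝ) < ((n + 1).factorial : ℝ) := by positivity
  set η : ℝ := ε / ((n + 1).factorial : ℝ) with hη
  have hηpos : 0 < η := by positivity
  obtain ⟨L, hL⟩ := hdiff
  have hlo := (hasFDerivAt_iff_isLittleO_nhds_zero.mp hL).def hηpos
  obtain ⟨δ, hδ, hball⟩ := Metric.eventually_nhds_iff.mp hlo
  refine ⟨δ, hδ, fun x hx => ?_⟩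
  set M : Matrix (Fin (n + 1)) (Fin (n + 1)) ℝ := Matrix.of fun j : Fin (n + 1) =>
            Fin.cons (f (x j)) (fun i : Fin n => x j i) with hM
  have hLx : ∀ y : EuclideanSpace ℝ (Fin n),
      L y = ∑ i, y i * L (EuclideanSpace.single i 1) := by
    intro y
    have h := (EuclideanSpace.basisFun (Fin n) ℝ).sum_repr y
    conv_lhs => rw [← h]
    simp [map_sum]
  let c : Fin (n + 1) → ℝ := Fin.cons 1 (fun i => - L (EuclideanSpace.single i 1))
  have hdet : (M.updateCol 0 (fun k => ∑ i, (c i) • M k i)).det = M.det := by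
    rw [Matrix.det_updateCol_sum]
    simp [c]
  have hcol : ∀ k, ∑ i, (c i) • M k i = f (x k) - L (x k) := by
    intro k
    rw [Fin.sum_univ_succ, hLx]
    simp [c, hM, sub_eq_add_neg, mul_comm]
  simp only [hcol] at hdet
  rw [← hdet]
  set A := M.updateCol 0 (fun k => f (x k) - L (x k)) with hA
  let b : Fin (n + 1) → ℝ := Fin.cons η (fun _ => 1)
  have hb : ∀ k i, |A k i| ≤ b i * ‖x k‖ := by
    intro k i
    refine Fin.cases ?_ (fun i => ?_) i
    · have h := hball (y := x k) (by simpa using hx k)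
      simpa [hA, b, hf] using h
    · have h := PiLp.norm_apply_le (x k) i
      simpa [hA, hM, b, Matrix.updateCol_apply] using h
  have hbprod : ∏ i, b i = η := by
    rw [Fin.prod_univ_succ]; simp [b]
  rw [Matrix.det_apply']
  calc _ ≤ ∑ σ : Equiv.Perm (Fin (n + 1)), |((Equiv.Perm.sign σ : ℤ) : ℝ) * ∏ i, A (σ i) i| :=
        Finset.abs_sum_le_sum_abs _ _
    _ ≤ ∑ σ : Equiv.Perm (Fin (n + 1)), η * ∏ j, ‖x j‖ := by
        refine Finset.sum_le_sum fun σ _ => ?_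
        have hs : |((Equiv.Perm.sign σ : ℤ) : ℝ)| = 1 := by
          rcases Int.units_eq_one_or (Equiv.Perm.sign σ) with h | h <;> simp [h]
        rw [abs_mul, hs, one_mul, Finset.abs_prod]
        calc _ ≤ ∏ i, (b i * ‖x (σ i)‖) :=
              Finset.prod_le_prod (fun _ _ => abs_nonneg _) (fun i _ => hb _ _)
          _ = η * ∏ j, ‖x j‖ := by
              rw [Finset.prod_mul_distrib, hbprod, Equiv.prod_comp σ (fun j => ‖x j‖)]
    _ = ε * ∏ j, ‖x j‖ := by
        rw [Finset.sum_const, Finset.card_univ, Fintype.card_perm, Fintype.card_fin,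
          nsmul_eq_mul, ← mul_assoc, hη, mul_div_cancel₀ _ hN.ne']
end

section
/- Relaxed sufficient conditions for differentiability (two variables): suppose (i) the map t ↦ f(t, 0) is differentiable at 0 (the partial derivative f_x exists at the origin); (ii) there is a neighborhood U of (0,0) in ℝ × ℝ such that for every (a, b) ∈ U the map t ↦ f(a, t) is differentiable at b, with derivative f_y(a, b); and (iii) the function (a, b) ↦ f_y(a, b) is continuous at (0, 0). Then f is differentiable at (0, 0). -/
open Filter Asymptotics Topology

/-- **Relaxed sufficient conditions for differentiability (two variables).** If the
partial derivative `f_x` exists at the origin, the partial derivative `f_y` exists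
in a neighborhood of the origin, and `f_y` is continuous at the origin, then `f` is
differentiable at `(0, 0)`. -/
theorem relaxed_sufficient_two_variables (f : ℝ × ℝ → ℝ) (fy : ℝ × ℝ → ℝ)
    (hx : DifferentiableAt ℝ (fun t : ℝ => f (t, 0)) 0)
    (hy : ∃ U ∈ 𝓝 ((0, 0) : ℝ × ℝ), ∀ p ∈ U,
      HasDerivAt (fun t : ℝ => f (p.1, t)) (fy p) p.2)
    (hcont : ContinuousAt fy (0, 0)) :
    DifferentiableAt ℝ f (0, 0) := by
  obtain ⟨U, hU, hy⟩ := hy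
  set a := deriv (fun t : ℝ => f (t, 0)) 0 with ha
  set b := fy (0, 0) with hb
  have hxo := hasDerivAt_iff_isLittleO.1 hx.hasDerivAt
  refine HasFDerivAt.differentiableAt
    (f' := a • ContinuousLinearMap.fst ℝ ℝ ℝ + b • ContinuousLinearMap.snd ℝ ℝ ℝ) ?_
  rw [hasFDerivAt_iff_isLittleO, isLittleO_iff]
  intro c hc
  have hc2 : 0 < c / 2 := by positivity
  obtain ⟨d1, hd1, h1⟩ := Metric.eventually_nhds_iff.1 (isLittleO_iff.1 hxo hc2)
  obtain ⟨d2, hd2, h2⟩ := Metric.continuousAt_iff.1 hcont (c / 2) hc2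
  obtain ⟨d3, hd3, h3⟩ := Metric.mem_nhds_iff.1 hU
  refine Metric.eventually_nhds_iff.2 ⟨min d1 (min d2 d3), by positivity, ?_⟩
  rintro ⟨x, y⟩ hxy
  rw [lt_min_iff, lt_min_iff] at hxy
  obtain ⟨e1, e2, e3⟩ := hxy
  have hd : dist (x, y) ((0, 0) : ℝ × ℝ) = max |x| |y| := by simp [Prod.dist_eq]
  rw [hd] at e1 e2 e3
  have hn : ‖(x, y) - ((0, 0) : ℝ × ℝ)‖ = max |x| |y| := by rw [← dist_eq_norm, hd]
  rw [hn]
  have k1 := h1 (y := x) (by simpa using lt_of_le_of_lt (le_max_left _ _) e1)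
  have key : ∀ t ∈ Set.Icc (-|y|) |y|,
      dist (x, t) ((0, 0) : ℝ × ℝ) ≤ max |x| |y| := by
    intro t ht
    have : |t| ≤ |y| := abs_le.2 ht
    simp only [Prod.dist_eq, Real.dist_eq, sub_zero]
    exact max_le_max le_rfl this
  have k2 := Convex.norm_image_sub_le_of_norm_hasDerivWithin_le
    (f := fun t : ℝ => f (x, t) - b * t) (f' := fun t => fy (x, t) - b)
    (s := Set.Icc (-|y|) |y|) (x := 0) (y := y) (C := c / 2)
    (fun t ht => by
      have hm : (x, t) ∈ U := h3 (lt_of_le_of_lt (key t ht) e3)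
      have h := (hy _ hm).sub ((hasDerivAt_id t).const_mul b)
      simp only [mul_one] at h
      exact h.hasDerivWithinAt)
    (fun t ht => (h2 (lt_of_le_of_lt (key t ht) e2)).le)
    (convex_Icc _ _) (by simp) (abs_le.1 le_rfl)
  simp only [Real.norm_eq_abs, sub_zero, mul_zero, smul_eq_mul] at k1 k2
  have m1 := mul_le_mul_of_nonneg_left (le_max_left |x| |y|) hc2.le
  have m2 := mul_le_mul_of_nonneg_left (le_max_right |x| |y|) hc2.le
  have e : f (x, y) - f (0, 0) - (a • ContinuousLinearMap.fst ℝ ℝ ℝ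
      + b • ContinuousLinearMap.snd ℝ ℝ ℝ) ((x, y) - (0, 0))
      = (f (x, y) - b * y - f (x, 0)) + (f (x, 0) - f (0, 0) - x * a) := by
    simp
    ring
  rw [e, Real.norm_eq_abs]
  refine (abs_add_le _ _).trans ?_
  linarith
end

section
/- Lemma (one continuous partial derivative upgrades differentiability): let j : Fin n, and suppose (i) the function g : EuclideanSpace ℝ (Fin n) → ℝ defined by g(x) = f(x − (x j) • eⱼ) (i.e. f evaluated at x with its j-th coordinate replaced by 0) is differentiable at 0; (ii) there is a neighborhood U of 0 such that for every x ∈ U the map t ↦ f(x + (t − x j) • eⱼ) is differentiable at x j, with derivative f_{xⱼ}(x); and (iii) the function x ↦ f_{xⱼ}(x) is continuous at 0. Then f is differentiable at 0. -/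
open Filter Asymptotics Topology

/-- **Lemma: one continuous partial derivative upgrades differentiability.** Let
`j : Fin n` and suppose (i) `g x = f (x - (x j) • eⱼ)` (that is, `f` with the `j`-th
coordinate replaced by `0`) is differentiable at the origin; (ii) the `j`-th partial
derivative `f_{xⱼ}` of `f` exists in a neighborhood of the origin; and (iii)
`f_{xⱼ}` is continuous at the origin. Then `f` is differentiable at the origin. -/
theorem one_continuous_partial_upgrades (n : ℕ) (f : EuclideanSpace ℝ (Fin n) → ℝ)
    (hf : f 0 = 0) (j : Fin n) (fj : EuclideanSpace ℝ (Fin n) → ℝ)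
    (hg : DifferentiableAt ℝ
      (fun x : EuclideanSpace ℝ (Fin n) =>
        f (x - (x j) • EuclideanSpace.single j (1 : ℝ))) 0)
    (hj : ∃ U ∈ 𝓝 (0 : EuclideanSpace ℝ (Fin n)), ∀ x ∈ U,
      HasDerivAt (fun t : ℝ => f (x + (t - x j) • EuclideanSpace.single j (1 : ℝ)))
        (fj x) (x j))
    (hcont : ContinuousAt fj 0) :
    DifferentiableAt ℝ f 0 := by
  obtain ⟨U, hU, hd⟩ := hj
  set e : EuclideanSpace ℝ (Fin n) := EuclideanSpace.single j (1 : ℝ) with he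
  have hej : e j = 1 := by simp [he]
  have hne : ‖e‖ = 1 := by simp [he]
  have key : HasFDerivAt (fun x : EuclideanSpace ℝ (Fin n) => f x - f (x - (x j) • e))
      (fj 0 • (EuclideanSpace.proj j : EuclideanSpace ℝ (Fin n) →L[ℝ] ℝ)) 0 := by
    rw [hasFDerivAt_iff_isLittleO_nhds_zero, isLittleO_iff]
    intro c hc
    have h1 : ∀ᶠ x in 𝓝 (0 : EuclideanSpace ℝ (Fin n)), x ∈ U ∧ dist (fj x) (fj 0) < c :=
      (eventually_mem_set.mpr hU).and (Metric.tendsto_nhds.mp hcont c hc)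
    obtain ⟨δ, hδ, hball⟩ := Metric.eventually_nhds_iff.mp h1
    refine Metric.eventually_nhds_iff.mpr ⟨δ / 2, by positivity, fun x hx => ?_⟩
    rw [dist_zero_right] at hx
    have hxj : |x j| ≤ ‖x‖ := by
      simpa using PiLp.norm_apply_le x j
    have hpt : ∀ s ∈ Set.uIcc 0 (x j), dist (x + (s - x j) • e) 0 < δ := by
      intro s hs
      rw [dist_zero_right]
      have h2 : |s - x j| ≤ |x j| := by
        have := Set.abs_sub_right_of_mem_uIcc hs
        rw [abs_sub_comm]
        simpa using this
      calc ‖x + (s - x j) • e‖ ≤ ‖x‖ + ‖(s - x j) • e‖ := norm_add_le _ _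
        _ = ‖x‖ + |s - x j| := by rw [norm_smul, hne, mul_one, Real.norm_eq_abs]
        _ < δ := by linarith
    have hder : ∀ s ∈ Set.uIcc 0 (x j), HasDerivWithinAt
        (fun t : ℝ => f (x + (t - x j) • e) - t * fj 0)
        (fj (x + (s - x j) • e) - fj 0) (Set.uIcc 0 (x j)) s := by
      intro s hs
      have h3 := hd _ (hball (hpt s hs)).1
      have h4 : (x + (s - x j) • e) j = s := by simp [hej]
      rw [h4] at h3
      have h5 : (fun t : ℝ => f (x + (s - x j) • e + (t - s) • e))
          = fun t : ℝ => f (x + (t - x j) • e) := by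
        funext t
        congr 1
        module
      rw [h5] at h3
      have h6 := h3.sub ((hasDerivAt_id s).mul_const (fj 0))
      rw [one_mul] at h6
      exact h6.hasDerivWithinAt
    have hmv := (convex_uIcc (0 : ℝ) (x j)).norm_image_sub_le_of_norm_hasDerivWithin_le hder
      (C := c) (fun s hs => by
        have := (hball (hpt s hs)).2
        rw [Real.dist_eq] at this
        exact this.le) Set.left_mem_uIcc Set.right_mem_uIcc
    have h7 : x + (0 - x j) • e = x - x j • e := by module
    simp only [sub_self, zero_smul, add_zero, zero_mul, sub_zero, h7] at hmv
    have h8 : c * ‖x j‖ ≤ c * ‖x‖ := mul_le_mul_of_nonneg_left hxj hc.le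
    refine le_trans (le_of_eq ?_) (hmv.trans h8)
    congr 1
    simp
    ring
  have := key.differentiableAt.add hg
  refine this.congr_of_eventuallyEq (Eventually.of_forall fun x => ?_)
  simp
end

section
/- Relaxed sufficient conditions for differentiability (n variables): suppose that for every j : Fin n with j < n − 1 the following holds: there is a neighborhood of 0 such that for every x in this neighborhood satisfying x i = 0 for all i < j, the partial derivative f_{xⱼ}(x) exists, and the function x ↦ f_{xⱼ}(x), restricted to points x with x i = 0 for all i < j, is continuous at 0; and suppose that for j = n − 1 the partial derivative f_{xⱼ}(0) exists at the origin. Then f is differentiable at 0. -/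
open Filter Asymptotics Topology

/-- Zero out the coordinates with index below `k`. -/
noncomputable def zeroBelow {n : ℕ} (k : ℕ) (x : EuclideanSpace ℝ (Fin n)) :
    EuclideanSpace ℝ (Fin n) :=
  WithLp.toLp 2 (fun i : Fin n => if (i : ℕ) < k then 0 else x i)

lemma zeroBelow_apply {n : ℕ} (k : ℕ) (x : EuclideanSpace ℝ (Fin n)) (i : Fin n) :
    zeroBelow k x i = if (i : ℕ) < k then 0 else x i := rfl

lemma zeroBelow_split {n : ℕ} (j : Fin n) (x : EuclideanSpace ℝ (Fin n)) :
    zeroBelow (j : ℕ) x = zeroBelow ((j : ℕ) + 1) x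
      + x j • EuclideanSpace.single j (1 : ℝ) := by
  ext i
  simp only [PiLp.add_apply, PiLp.smul_apply, zeroBelow_apply, PiLp.single_apply, smul_eq_mul]
  rcases eq_or_ne i j with rfl | h
  · simp
  · have h' : (i : ℕ) ≠ j := fun hh => h (Fin.ext hh)
    by_cases h3 : (i : ℕ) < j
    · simp [h, h3, Nat.lt_succ_of_lt h3]
    · have : ¬ (i : ℕ) < j + 1 := by omega
      simp [h, h3, this]

lemma norm_segment_le {n : ℕ} (j : Fin n) (x : EuclideanSpace ℝ (Fin n)) (t : ℝ)
    (ht : |t| ≤ |x j|) :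
    ‖zeroBelow ((j : ℕ) + 1) x + t • EuclideanSpace.single j (1 : ℝ)‖ ≤ ‖x‖ := by
  rw [EuclideanSpace.norm_eq, EuclideanSpace.norm_eq]
  apply Real.sqrt_le_sqrt
  apply Finset.sum_le_sum
  intro i _
  apply pow_le_pow_left₀ (norm_nonneg _)
  simp only [PiLp.add_apply, PiLp.smul_apply, zeroBelow_apply, PiLp.single_apply, smul_eq_mul]
  rcases eq_or_ne i j with rfl | h
  · simpa using ht
  · by_cases h3 : (i : ℕ) < j + 1
    · simp [h, h3]
    · simp [h, h3]

lemma step_littleO {n : ℕ} (j : Fin n) (f g : EuclideanSpace ℝ (Fin n) → ℝ)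
    (hU : ∃ U ∈ 𝓝 (0 : EuclideanSpace ℝ (Fin n)), ∀ x ∈ U,
          (∀ i : Fin n, (i : ℕ) < (j : ℕ) → x i = 0) →
          HasDerivAt
            (fun t : ℝ => f (x + (t - x j) • EuclideanSpace.single j (1 : ℝ)))
            (g x) (x j))
    (hc : ContinuousWithinAt g
          {x : EuclideanSpace ℝ (Fin n) | ∀ i : Fin n, (i : ℕ) < (j : ℕ) → x i = 0} 0) :
    (fun x => f (zeroBelow (j : ℕ) x) - f (zeroBelow ((j : ℕ) + 1) x) - g 0 * x j)
      =o[𝓝 0] fun x => x := by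
  rw [Asymptotics.isLittleO_iff]
  intro ε hε
  obtain ⟨U, hU, hd⟩ := hU
  obtain ⟨r, hr, hrU⟩ := Metric.mem_nhds_iff.1 hU
  obtain ⟨d, hd0, hdc⟩ := Metric.continuousWithinAt_iff.1 hc ε hε
  filter_upwards [Metric.ball_mem_nhds 0 (lt_min hr hd0)] with x hx
  have hx' : ‖x‖ < min r d := by simpa using hx
  set y := zeroBelow ((j : ℕ) + 1) x with hy
  set e : EuclideanSpace ℝ (Fin n) := EuclideanSpace.single j (1 : ℝ) with he
  have hco : ∀ t : ℝ, (y + t • e) j = t := by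
    intro t
    simp [hy, he, zeroBelow_apply]
  have hz : ∀ t : ℝ, ∀ i : Fin n, (i : ℕ) < (j : ℕ) → (y + t • e) i = 0 := by
    intro t i hi
    have : i ≠ j := by rintro rfl; exact lt_irrefl _ hi
    simp [hy, he, zeroBelow_apply, this, Nat.lt_succ_of_lt hi]
  have key : ∀ t ∈ Metric.closedBall (0 : ℝ) |x j|,
      HasDerivAt (fun t : ℝ => f (y + t • e) - g 0 * t) (g (y + t • e) - g 0) t ∧
      ‖g (y + t • e) - g 0‖ ≤ ε := by
    intro t ht
    have ht' : |t| ≤ |x j| := by simpa using ht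
    have hn := (norm_segment_le j x t ht').trans_lt hx'
    constructor
    · have h := hd (y + t • e)
        (hrU (by simpa using hn.trans_le (min_le_left _ _))) (hz t)
      rw [hco] at h
      have h' : HasDerivAt (fun s : ℝ => f (y + s • e)) (g (y + t • e)) t := by
        convert h using 3 with s
        rw [sub_smul]
        abel
      have h3 := h'.sub ((hasDerivAt_id t).const_mul (g 0))
      rw [mul_one] at h3
      exact h3
    · have h := hdc (x := y + t • e) (hz t)
        (by simpa using hn.trans_le (min_le_right _ _))
      rw [Real.dist_eq] at h
      exact h.le
  have hm := (convex_closedBall (0 : ℝ) |x j|).norm_image_sub_le_of_norm_hasDerivWithin_le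
    (fun t ht => (key t ht).1.hasDerivWithinAt) (fun t ht => (key t ht).2)
    (x := 0) (y := x j) (by simp) (by simp)
  rw [zeroBelow_split]
  have hj : ‖x j‖ ≤ ‖x‖ := PiLp.norm_apply_le x j
  calc _ = ‖f (y + x j • e) - g 0 * x j - (f (y + (0 : ℝ) • e) - g 0 * 0)‖ := by
        congr 1
        simp only [zero_smul, add_zero, mul_zero, sub_zero]
        ring
    _ ≤ ε * ‖x j - 0‖ := hm
    _ ≤ ε * ‖x‖ := by
        rw [sub_zero]
        exact mul_le_mul_of_nonneg_left hj hε.le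

/-- **Relaxed sufficient conditions for differentiability (n variables).** Suppose
that for every `j : Fin n` with `j < n - 1`, the `j`-th partial derivative
`f_{xⱼ}` exists near the origin at points whose first `j` coordinates vanish, and is
continuous at the origin along the set of such points; and that for `j = n - 1` the
`j`-th partial derivative merely exists at the origin. Then `f` is differentiable at
the origin. -/
theorem relaxed_sufficient_n_variables (n : ℕ) (hn : 1 ≤ n)
    (f : EuclideanSpace ℝ (Fin n) → ℝ) (hf : f 0 = 0)
    (fd : Fin n → EuclideanSpace ℝ (Fin n) → ℝ)
    (h1 : ∀ j : Fin n, (j : ℕ) < n - 1 →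
      (∃ U ∈ 𝓝 (0 : EuclideanSpace ℝ (Fin n)), ∀ x ∈ U,
          (∀ i : Fin n, (i : ℕ) < (j : ℕ) → x i = 0) →
          HasDerivAt
            (fun t : ℝ => f (x + (t - x j) • EuclideanSpace.single j (1 : ℝ)))
            (fd j x) (x j)) ∧
        ContinuousWithinAt (fd j)
          {x : EuclideanSpace ℝ (Fin n) | ∀ i : Fin n, (i : ℕ) < (j : ℕ) → x i = 0} 0)
    (h2 : ∀ j : Fin n, (j : ℕ) = n - 1 →
      ∃ c : ℝ,
        HasDerivAt (fun t : ℝ => f (t • EuclideanSpace.single j (1 : ℝ))) c 0) :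
    DifferentiableAt ℝ f 0 := by
  have hstep : ∀ j : Fin n, ∃ c : ℝ,
      (fun x => f (zeroBelow (j : ℕ) x) - f (zeroBelow ((j : ℕ) + 1) x) - c * x j)
        =o[𝓝 0] fun x => x := by
    intro j
    by_cases hj : (j : ℕ) < n - 1
    · exact ⟨fd j 0, step_littleO j f (fd j) (h1 j hj).1 (h1 j hj).2⟩
    · have hj' : (j : ℕ) = n - 1 := by have := j.2; omega
      obtain ⟨c, hc⟩ := h2 j hj'
      refine ⟨c, ?_⟩
      have hy : ∀ x : EuclideanSpace ℝ (Fin n), zeroBelow ((j : ℕ) + 1) x = 0 := by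
        intro x
        ext i
        have : (i : ℕ) < j + 1 := by have := i.2; omega
        simp [zeroBelow_apply, this]
      have hT : Tendsto (fun x : EuclideanSpace ℝ (Fin n) => x j) (𝓝 0) (𝓝 0) := by
        have : Continuous (fun x : EuclideanSpace ℝ (Fin n) => x j) := by fun_prop
        simpa using this.tendsto 0
      have h := (hasDerivAt_iff_isLittleO.1 hc).comp_tendsto hT
      have hb : (fun x : EuclideanSpace ℝ (Fin n) => x j) =O[𝓝 0] fun x => x :=
        Asymptotics.isBigO_of_le _ (fun x => PiLp.norm_apply_le x j)
      simp only [Function.comp_def, sub_zero, zero_smul, hf, smul_eq_mul] at h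
      refine (h.trans_isBigO hb).congr_left ?_
      intro x
      rw [zeroBelow_split, hy, zero_add, hf, sub_zero, mul_comm]
  choose c hc using hstep
  have hsum := Asymptotics.IsLittleO.fun_sum (s := Finset.univ) (fun j _ => hc j)
  have hdiff : HasFDerivAt f
      (∑ j, c j • (EuclideanSpace.proj j : EuclideanSpace ℝ (Fin n) →L[ℝ] ℝ)) 0 := by
    rw [hasFDerivAt_iff_isLittleO]
    simp only [sub_zero, hf]
    refine hsum.congr_left ?_
    intro x
    have htel : ∑ j : Fin n, (f (zeroBelow (j : ℕ) x) - f (zeroBelow ((j : ℕ) + 1) x))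
        = f x := by
      rw [Fin.sum_univ_eq_sum_range
        (fun k => f (zeroBelow k x) - f (zeroBelow (k + 1) x)) n,
        Finset.sum_range_sub']
      have h0 : zeroBelow 0 x = x := by ext i; simp [zeroBelow_apply]
      have hn0 : zeroBelow n x = 0 := by ext i; simp [zeroBelow_apply]
      rw [h0, hn0, hf, sub_zero]
    rw [Finset.sum_sub_distrib, htel]
    simp
  exact hdiff.differentiableAt
end

section
/- The function G is continuous at every point of the coordinate axes: for all a b : ℝ with a = 0 or b = 0, G is continuous at (a, b) (ContinuousAt G (a, b)). -/
open Filter Asymptotics Topology Classical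

/-- The Dirichlet function: `D t = 1` if `t` is rational, `D t = 0` otherwise. -/
noncomputable def dirichlet : ℝ → ℝ := fun t =>
  if t ∈ Set.range ((↑) : ℚ → ℝ) then 1 else 0

/-- `G(x, y) = x y D(x y)` where `D` is the Dirichlet function. -/
noncomputable def GFun : ℝ × ℝ → ℝ := fun p => p.1 * p.2 * dirichlet (p.1 * p.2)

/-- `G` is continuous at every point of the coordinate axes. -/
theorem GFun_continuous_on_axes :
    ∀ a b : ℝ, a = 0 ∨ b = 0 → ContinuousAt GFun (a, b) := by
  intro a b hab
  have h0 : a * b = 0 := mul_eq_zero.mpr hab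
  have hG : GFun (a, b) = 0 := by simp [GFun, h0]
  have hlim : Tendsto (fun p : ℝ × ℝ => |p.1 * p.2|) (𝓝 (a, b)) (𝓝 0) := by
    have hc : Continuous (fun p : ℝ × ℝ => |p.1 * p.2|) := by fun_prop
    have ht := hc.tendsto (a, b)
    simpa only [h0, abs_zero] using ht
  unfold ContinuousAt
  rw [hG]
  refine squeeze_zero_norm (fun p => ?_) hlim
  rw [Real.norm_eq_abs]
  unfold GFun dirichlet
  split_ifs
  · simp
  · simp only [mul_zero, abs_zero]
    exact abs_nonneg _
end

section
/- Necessity part of the Cauchy-like criterion: if f is differentiable at 0, then (a) for every index i the map t ↦ f(t • eᵢ) is differentiable at 0, and (b) the function x ↦ f(x) − ∑_{i} f((x i) • eᵢ) is o(‖x‖) as x → 0. -/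
open Filter Asymptotics Topology

/-- **Necessity part of the Cauchy-like criterion.** If `f` (with `f 0 = 0`) is
differentiable at the origin, then (a) every partial derivative of `f` exists at the
origin, and (b) `f x - ∑ i, f ((x i) • eᵢ) = o(‖x‖)` as `x → 0`. -/
theorem cauchy_like_criterion_necessity (n : ℕ) (f : EuclideanSpace ℝ (Fin n) → ℝ)
    (hf : f 0 = 0) (hdiff : DifferentiableAt ℝ f 0) :
    (∀ i : Fin n,
        DifferentiableAt ℝ (fun t : ℝ => f (t • EuclideanSpace.single i (1 : ℝ))) 0) ∧
      (fun x : EuclideanSpace ℝ (Fin n) =>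
          f x - ∑ i : Fin n, f ((x i) • EuclideanSpace.single i (1 : ℝ)))
        =o[𝓝 0] fun x : EuclideanSpace ℝ (Fin n) => ‖x‖ := by
  have key : ∀ x : EuclideanSpace ℝ (Fin n),
      ∑ i : Fin n, (x i) • EuclideanSpace.single i (1 : ℝ) = x := by
    intro x
    have h := (EuclideanSpace.basisFun (Fin n) ℝ).sum_repr x
    simpa using h
  obtain ⟨L, hL⟩ := hdiff
  have hg : (fun x => f x - L x) =o[𝓝 0] fun x : EuclideanSpace ℝ (Fin n) => x := by
    have h := hL.isLittleO
    simpa [hf] using h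
  refine ⟨fun i => ?_, ?_⟩
  · have h1 : DifferentiableAt ℝ f ((0 : ℝ) • EuclideanSpace.single i (1 : ℝ)) := by
      rw [zero_smul]
      exact hL.differentiableAt
    have h2 : DifferentiableAt ℝ
        (fun t : ℝ => t • (EuclideanSpace.single i (1 : ℝ) : EuclideanSpace ℝ (Fin n))) 0 := by
      fun_prop
    exact DifferentiableAt.comp (0 : ℝ) h1 h2
  · have hi : ∀ i : Fin n, (fun x : EuclideanSpace ℝ (Fin n) =>
        f ((x i) • EuclideanSpace.single i (1 : ℝ))
          - L ((x i) • EuclideanSpace.single i (1 : ℝ))) =o[𝓝 0]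
        fun x : EuclideanSpace ℝ (Fin n) => x := by
      intro i
      have ht : Tendsto (fun x : EuclideanSpace ℝ (Fin n) =>
          (x i) • (EuclideanSpace.single i (1 : ℝ) : EuclideanSpace ℝ (Fin n)))
          (𝓝 0) (𝓝 0) := by
        have hc : Continuous (fun x : EuclideanSpace ℝ (Fin n) =>
          (x i) • (EuclideanSpace.single i (1 : ℝ) : EuclideanSpace ℝ (Fin n))) := by
          fun_prop
        simpa using hc.tendsto 0
      refine (hg.comp_tendsto ht).trans_isBigO ?_
      refine IsBigO.of_bound 1 (Eventually.of_forall fun x => ?_)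
      have := PiLp.norm_apply_le x i
      simpa [norm_smul] using this
    have hs := IsLittleO.sum (s := Finset.univ) (fun i _ => hi i)
    refine ((hg.sub hs).norm_right).congr_left fun x => ?_
    have hx : ∑ i : Fin n, L ((x i) • EuclideanSpace.single i (1 : ℝ)) = L x := by
      rw [← map_sum, key x]
    simp only [Finset.sum_apply, Finset.sum_sub_distrib, hx]
    ring
end

section
/- Sufficiency part of the Cauchy-like criterion: if (a) for every index i the map t ↦ f(t • eᵢ) is differentiable at 0 with derivative Aᵢ, and (b) the function x ↦ f(x) − ∑_{i} f((x i) • eᵢ) is o(‖x‖) as x → 0, then x ↦ f(x) − ∑_{i} Aᵢ · (x i) is o(‖x‖) as x → 0; in particular f is differentiable at 0. -/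
open Filter Asymptotics Topology

/-- **Sufficiency part of the Cauchy-like criterion.** If (a) for every `i` the map
`t ↦ f (t • eᵢ)` is differentiable at `0` with derivative `Aᵢ`, and (b)
`f x - ∑ i, f ((x i) • eᵢ) = o(‖x‖)` as `x → 0`, then
`f x - ∑ i, Aᵢ * (x i) = o(‖x‖)` as `x → 0`; in particular `f` is differentiable at
the origin. -/
theorem cauchy_like_criterion_sufficiency (n : ℕ) (f : EuclideanSpace ℝ (Fin n) → ℝ)
    (hf : f 0 = 0) (A : Fin n → ℝ)
    (ha : ∀ i : Fin n,
      HasDerivAt (fun t : ℝ => f (t • EuclideanSpace.single i (1 : ℝ))) (A i) 0)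
    (hb : (fun x : EuclideanSpace ℝ (Fin n) =>
        f x - ∑ i : Fin n, f ((x i) • EuclideanSpace.single i (1 : ℝ)))
      =o[𝓝 0] fun x : EuclideanSpace ℝ (Fin n) => ‖x‖) :
    ((fun x : EuclideanSpace ℝ (Fin n) => f x - ∑ i : Fin n, A i * x i)
        =o[𝓝 0] fun x : EuclideanSpace ℝ (Fin n) => ‖x‖) ∧
      DifferentiableAt ℝ f 0 := by
  have key : (fun x : EuclideanSpace ℝ (Fin n) => f x - ∑ i : Fin n, A i * x i)
        =o[𝓝 0] fun x : EuclideanSpace ℝ (Fin n) => ‖x‖ := by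
    have h1 : ∀ i : Fin n, (fun x : EuclideanSpace ℝ (Fin n) =>
        f ((x i) • EuclideanSpace.single i (1 : ℝ)) - A i * x i)
        =o[𝓝 0] fun x : EuclideanSpace ℝ (Fin n) => ‖x‖ := by
      intro i
      have h := (hasDerivAt_iff_isLittleO.mp (ha i))
      have ht : Tendsto (fun x : EuclideanSpace ℝ (Fin n) => x i) (𝓝 0) (𝓝 0) := by
        have hc : Continuous (fun x : EuclideanSpace ℝ (Fin n) => x i) := by fun_prop
        simpa using hc.tendsto 0
      have h2 := h.comp_tendsto ht
      have h3 : (fun x : EuclideanSpace ℝ (Fin n) => x i) =O[𝓝 0]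
          fun x : EuclideanSpace ℝ (Fin n) => ‖x‖ :=
        IsBigO.of_bound 1 (Eventually.of_forall fun x => by
          simpa using PiLp.norm_apply_le x i)
      have h4 : (fun x : EuclideanSpace ℝ (Fin n) =>
          f ((x i) • EuclideanSpace.single i (1 : ℝ)) - A i * x i)
          =o[𝓝 0] fun x : EuclideanSpace ℝ (Fin n) => x i := by
        refine h2.congr (fun x => ?_) (fun x => ?_)
        · simp only [Function.comp, zero_smul, hf, sub_zero, smul_eq_mul]
          ring
        · simp
      exact h4.trans_isBigO h3
    have h5 := hb.add (IsLittleO.fun_sum (s := Finset.univ) fun i _ => h1 i)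
    refine h5.congr_left fun x => ?_
    rw [Finset.sum_sub_distrib]
    ring
  refine ⟨key, ?_⟩
  have hd : HasFDerivAt f
      (∑ i : Fin n, A i • (EuclideanSpace.proj i : EuclideanSpace ℝ (Fin n) →L[ℝ] ℝ)) 0 := by
    rw [hasFDerivAt_iff_isLittleO]
    refine (key.of_norm_right).congr (fun x => ?_) (fun x => ?_)
    · simp [hf, ContinuousLinearMap.sum_apply]
    · simp
  exact hd.differentiableAt
end
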